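/- arXiv:2303.00305 — 3 statements merged into one kernel-verified Lean document; each statement's English description precedes it below -/
import Mathlib

section
/- For every integer n ≥ 2, the group H(n) is an n-dimensional mixed dihedral group relative to X and Y, and its order is |H(n)| = 2^{n(n²+n+4)/2}. -/
/-- The commutator `[g,h] = g⁻¹h⁻¹gh` (paper convention). -/
def gcomm {G : Type*} [Group G] (g h : G) : G := g⁻¹ * h⁻¹ * g * h

/-- The generator index set for `H(n)`: `Sum.inl i` is `x_i`, `Sum.inr j` is `y_j`. -/
abbrev HGen (n : ℕ) := Fin n ⊕ Fin n

/-- The word `x_i` in the free group. -/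
def xw {n : ℕ} (i : Fin n) : FreeGroup (HGen n) := FreeGroup.of (Sum.inl i)

/-- The word `y_j` in the free group. -/
def yw {n : ℕ} (j : Fin n) : FreeGroup (HGen n) := FreeGroup.of (Sum.inr j)

/-- The word `z` in the free group, for a generator `z`. -/
def zw {n : ℕ} (z : HGen n) : FreeGroup (HGen n) := FreeGroup.of z

/-- The relators of the presentation of `H(n)`. -/
def HRels (n : ℕ) : Set (FreeGroup (HGen n)) :=
  {w | ∃ z, w = zw z ^ 2} ∪
  {w | ∃ i j, w = gcomm (xw i) (xw j)} ∪
  {w | ∃ i j, w = gcomm (yw i) (yw j)} ∪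
  {w | ∃ i j, w = gcomm (xw i) (yw j) ^ 2} ∪
  {w | ∃ i j k, w = gcomm (gcomm (yw j) (xw i)) (yw k)} ∪
  {w | ∃ i j z, w = gcomm (gcomm (xw i) (yw j)) (zw z) ^ 2} ∪
  {w | ∃ z₁ z₂ z₃ z₄, w = gcomm (gcomm (gcomm (zw z₁) (zw z₂)) (zw z₃)) (zw z₄)}

/-- The group `H(n)` defined by the presentation. -/
abbrev Hn (n : ℕ) := PresentedGroup (HRels n)

/-- The image of the generator `x_i` in `H(n)`. -/
def xH {n : ℕ} (i : Fin n) : Hn n := PresentedGroup.of (Sum.inl i)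

/-- The image of the generator `y_j` in `H(n)`. -/
def yH {n : ℕ} (j : Fin n) : Hn n := PresentedGroup.of (Sum.inr j)

/-- The subgroup `X = ⟨x_1, …, x_n⟩` of `H(n)`. -/
def XH (n : ℕ) : Subgroup (Hn n) := Subgroup.closure (Set.range (xH (n := n)))

/-- The subgroup `Y = ⟨y_1, …, y_n⟩` of `H(n)`. -/
def YH (n : ℕ) : Subgroup (Hn n) := Subgroup.closure (Set.range (yH (n := n)))

/-- `H` is an `n`-dimensional mixed dihedral group relative to `X` and `Y`:
`H` is finite, `X` and `Y` are elementary abelian of order `2^n`, `H = ⟨X ∪ Y⟩`, and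
`H/H' ≅ C_2^{2n}`. -/
def IsMixedDihedral {H : Type*} [Group H] (n : ℕ) (X Y : Subgroup H) : Prop :=
  Finite H ∧
  Nat.card X = 2 ^ n ∧ (∀ x ∈ X, x * x = 1) ∧
  Nat.card Y = 2 ^ n ∧ (∀ y ∈ Y, y * y = 1) ∧
  Subgroup.closure ((X : Set H) ∪ (Y : Set H)) = ⊤ ∧
  Nonempty ((H ⧸ commutator H) ≃* (Fin (2 * n) → Multiplicative (ZMod 2)))


/-! ### Elementary abelian lemmas -/

theorem gcomm_one_iff {G : Type*} [Group G] (g h : G) : gcomm g h = 1 ↔ g * h = h * g := by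
  unfold gcomm
  constructor
  · intro e
    have : h * g * (g⁻¹ * h⁻¹ * g * h) = h * g * 1 := by rw [e]
    simpa [mul_assoc] using this
  · intro e
    rw [mul_assoc, e]; group

theorem map_gcomm {G K : Type*} [Group G] [Group K] (f : G →* K) (g h : G) :
    f (gcomm g h) = gcomm (f g) (f h) := by simp [gcomm]

theorem pi_mem {ι : Type*} [Fintype ι] [DecidableEq ι] (S : AddSubmonoid (ι → ZMod 2))
    (h : ∀ i, Pi.single i 1 ∈ S) (v : ι → ZMod 2) : v ∈ S := by
  rw [← Finset.univ_sum_single v]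
  refine S.sum_mem fun i _ => ?_
  have h2 : ∀ t : ZMod 2, t = 0 ∨ t = 1 := by decide
  rcases h2 (v i) with e | e <;> rw [e]
  · simp
  · exact h i

section elemab
variable {G : Type*} [Group G] {ι : Type*} (h : ι → G)
  (hc : ∀ i j, h i * h j = h j * h i) (hs : ∀ i, h i * h i = 1)

theorem clos_comm (hc : ∀ i j, h i * h j = h j * h i) :
    ∀ a ∈ Subgroup.closure (Set.range h), ∀ b ∈ Subgroup.closure (Set.range h), a * b = b * a := by
  intro a ha b hb
  have := Subgroup.isMulCommutative_closure (k := Set.range h)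
    (by rintro _ ⟨i, rfl⟩ _ ⟨j, rfl⟩; exact hc i j)
  exact congrArg Subtype.val (this.is_comm.comm (⟨a, ha⟩ : Subgroup.closure (Set.range h)) ⟨b, hb⟩)

theorem clos_sq (hc : ∀ i j, h i * h j = h j * h i) (hs : ∀ i, h i * h i = 1) :
    ∀ a ∈ Subgroup.closure (Set.range h), a * a = 1 := by
  intro a ha
  induction ha using Subgroup.closure_induction with
  | mem x hx => obtain ⟨i, rfl⟩ := hx; exact hs i
  | one => simp
  | mul x y hx hy ex ey =>
    have e := clos_comm h hc x hx y hy
    calc x * y * (x * y) = x * (y * x) * y := by group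
      _ = (x * x) * (y * y) := by rw [← e]; group
      _ = 1 := by rw [ex, ey, one_mul]
  | inv x hx ex => rw [← mul_inv_rev, ex, inv_one]

theorem clos_card [Fintype ι] (hc : ∀ i j, h i * h j = h j * h i) (hs : ∀ i, h i * h i = 1) :
    Finite (Subgroup.closure (Set.range h)) ∧
    Nat.card (Subgroup.closure (Set.range h)) ≤ 2 ^ Fintype.card ι := by
  classical
  let C := Subgroup.closure (Set.range h)
  let : CommGroup C :=
    { (inferInstance : Group C) with
      mul_comm := fun a b => Subtype.ext (clos_comm h hc a a.2 b b.2) }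
  let := AddCommGroup.zmodModule (n := 2) (G := Additive C)
    (fun a => by
      rw [two_nsmul]
      exact congrArg Additive.ofMul (Subtype.ext (clos_sq h hc hs a.toMul a.toMul.2) :
        a.toMul * a.toMul = (1 : C)))
  let k : ι → Additive C := fun i => Additive.ofMul ⟨h i, Subgroup.subset_closure ⟨i, rfl⟩⟩
  let L : (ι → ZMod 2) →ₗ[ZMod 2] Additive C := Fintype.linearCombination (ZMod 2) k
  have hL : Function.Surjective (fun v => (L v).toMul) := by
    rintro ⟨a, ha⟩
    induction ha using Subgroup.closure_induction with
    | mem x hx =>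
      obtain ⟨i, rfl⟩ := hx
      refine ⟨Pi.single i 1, ?_⟩
      simp only [L, Fintype.linearCombination_apply_single, one_smul]; rfl
    | one => exact ⟨0, by simp only [map_zero]; rfl⟩
    | mul x y hx hy ex ey =>
      obtain ⟨u, hu⟩ := ex
      obtain ⟨w, hw⟩ := ey
      refine ⟨u + w, ?_⟩
      simp only at hu hw
      simp only [map_add, toMul_add, hu, hw]; rfl
    | inv x hx ex =>
      obtain ⟨u, hu⟩ := ex
      refine ⟨-u, ?_⟩
      simp only at hu
      simp only [map_neg, toMul_neg, hu]; rfl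
  refine ⟨Finite.of_surjective _ hL, ?_⟩
  have := Nat.card_le_card_of_surjective _ hL
  simpa using this
end elemab

/-! ### The model -/

abbrev PP (n : ℕ) := {p : Fin n × Fin n // p.1 < p.2}

theorem card_PP (n : ℕ) : 2 * Fintype.card (PP n) + n = n ^ 2 := by
  have e : PP n ≃ Σ k : Fin n, Fin k :=
    { toFun := fun p => ⟨p.1.2, ⟨p.1.1, p.2⟩⟩
      invFun := fun s => ⟨(⟨s.2, s.2.2.trans s.1.2⟩, s.1), s.2.2⟩
      left_inv := fun p => rfl
      right_inv := fun s => rfl }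
  rw [Fintype.card_congr e, Fintype.card_sigma]
  simp only [Fintype.card_fin]
  rw [Fin.sum_univ_eq_sum_range (fun i => i), mul_comm, Finset.sum_range_id_mul_two]
  rcases n with _ | n
  · rfl
  · simp; ring

@[ext] structure HModel (n : ℕ) where
  v : Fin n → ZMod 2
  a : Fin n → ZMod 2
  b : Fin n × Fin n → ZMod 2
  c : PP n × Fin n → ZMod 2

namespace HModel
variable {n : ℕ}

instance : Mul (HModel n) := ⟨fun g h =>
  ⟨g.v + h.v, g.a + h.a, fun p => g.b p + h.v p.1 * g.a p.2 + h.b p,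
   fun q => g.c q + h.v q.1.1.1 * g.b (q.1.1.2, q.2) + h.v q.1.1.2 * g.b (q.1.1.1, q.2)
     + h.v q.1.1.1 * h.v q.1.1.2 * g.a q.2 + h.c q⟩⟩
instance : One (HModel n) := ⟨⟨0, 0, 0, 0⟩⟩
instance : Inv (HModel n) := ⟨fun g =>
  ⟨-g.v, -g.a, fun p => -(g.b p - g.v p.1 * g.a p.2),
   fun q => -(g.c q - g.v q.1.1.1 * g.b (q.1.1.2, q.2) - g.v q.1.1.2 * g.b (q.1.1.1, q.2)
     + g.v q.1.1.1 * g.v q.1.1.2 * g.a q.2)⟩⟩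

@[simp] theorem mul_v (g h : HModel n) : (g * h).v = g.v + h.v := rfl
@[simp] theorem mul_a (g h : HModel n) : (g * h).a = g.a + h.a := rfl
@[simp] theorem mul_b (g h : HModel n) (p) : (g * h).b p = g.b p + h.v p.1 * g.a p.2 + h.b p := rfl
@[simp] theorem mul_c (g h : HModel n) (q) : (g * h).c q =
  g.c q + h.v q.1.1.1 * g.b (q.1.1.2, q.2) + h.v q.1.1.2 * g.b (q.1.1.1, q.2)
     + h.v q.1.1.1 * h.v q.1.1.2 * g.a q.2 + h.c q := rfl
@[simp] theorem one_v : (1 : HModel n).v = 0 := rfl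
@[simp] theorem one_a : (1 : HModel n).a = 0 := rfl
@[simp] theorem one_b : (1 : HModel n).b = 0 := rfl
@[simp] theorem one_c : (1 : HModel n).c = 0 := rfl
@[simp] theorem inv_v (g : HModel n) : (g⁻¹).v = -g.v := rfl
@[simp] theorem inv_a (g : HModel n) : (g⁻¹).a = -g.a := rfl
@[simp] theorem inv_b (g : HModel n) (p) : (g⁻¹).b p = -(g.b p - g.v p.1 * g.a p.2) := rfl
@[simp] theorem inv_c (g : HModel n) (q) : (g⁻¹).c q =
   -(g.c q - g.v q.1.1.1 * g.b (q.1.1.2, q.2) - g.v q.1.1.2 * g.b (q.1.1.1, q.2)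
     + g.v q.1.1.1 * g.v q.1.1.2 * g.a q.2) := rfl

instance : Group (HModel n) := Group.ofLeftAxioms
  (fun x y z => by ext <;> simp <;> ring)
  (fun x => by ext <;> simp)
  (fun x => by
    ext <;> simp only [mul_v, mul_a, mul_b, mul_c, inv_v, inv_a, inv_b, inv_c, one_v, one_a,
      one_b, one_c, Pi.add_apply, Pi.neg_apply, Pi.zero_apply] <;> ring)

def equivProd (n : ℕ) : HModel n ≃ (Fin n → ZMod 2) × (Fin n → ZMod 2) ×
    (Fin n × Fin n → ZMod 2) × (PP n × Fin n → ZMod 2) :=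
  { toFun := fun g => (g.v, g.a, g.b, g.c)
    invFun := fun t => ⟨t.1, t.2.1, t.2.2.1, t.2.2.2⟩
    left_inv := fun _ => rfl
    right_inv := fun _ => rfl }

instance : Finite (HModel n) := Finite.of_equiv _ (equivProd n).symm

theorem card_eq (n : ℕ) :
    Nat.card (HModel n) = 2 ^ n * 2 ^ (n + n * n + Fintype.card (PP n) * n) := by
  rw [Nat.card_congr (equivProd n)]
  simp [Nat.card_prod, pow_add, mul_assoc]

theorem two_z (t : ZMod 2) : t + t = 0 := CharTwo.add_self_eq_zero t

theorem v_gcomm (g h : HModel n) : (gcomm g h).v = 0 := by simp [gcomm]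
theorem a_gcomm (g h : HModel n) : (gcomm g h).a = 0 := by simp [gcomm]
theorem b_gcomm (g h : HModel n) (hg : g.v = 0) (ha : g.a = 0) : (gcomm g h).b = 0 := by
  ext p
  simp only [gcomm, mul_v, mul_a, mul_b, inv_v, inv_a, inv_b, hg, ha, Pi.add_apply,
    Pi.neg_apply, Pi.zero_apply]
  ring
theorem sq_one (g : HModel n) (hg : g.v = 0) : g ^ 2 = 1 := by
  rw [pow_two]; ext <;> simp [hg, two_z]
theorem comm_N (g h : HModel n) (hg : g.v = 0) (hh : h.v = 0) : gcomm g h = 1 := by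
  rw [gcomm_one_iff]; ext <;> simp [hg, hh] <;> ring
theorem comm_Z (g h : HModel n) (hg : g.v = 0) (ha : g.a = 0) (hb : g.b = 0) : gcomm g h = 1 := by
  rw [gcomm_one_iff]; ext <;> simp [hg, ha, hb] <;> ring

def gen (z : HGen n) : HModel n := match z with
  | Sum.inl i => ⟨Pi.single i 1, 0, 0, 0⟩
  | Sum.inr j => ⟨0, Pi.single j 1, 0, 0⟩

theorem gen_rels (n : ℕ) : ∀ r ∈ HRels n, FreeGroup.lift (gen (n := n)) r = 1 := by
  intro r hr
  simp only [HRels, Set.mem_union, Set.mem_ofPred_eq] at hr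
  rcases hr with (((((⟨z, rfl⟩ | ⟨i, j, rfl⟩) | ⟨i, j, rfl⟩) | ⟨i, j, rfl⟩) | ⟨i, j, k, rfl⟩) |
    ⟨i, j, z, rfl⟩) | ⟨z₁, z₂, z₃, z₄, rfl⟩
  · rcases z with i | j
    · rw [zw, map_pow, FreeGroup.lift_apply_of, pow_two]
      simp only [gen]
      ext <;> simp [two_z]
    · simp only [zw, map_pow, FreeGroup.lift_apply_of]
      exact sq_one _ rfl
  · simp only [xw, map_gcomm, FreeGroup.lift_apply_of, gen, gcomm_one_iff]
    ext <;> simp [add_comm]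
  · simp only [yw, map_gcomm, FreeGroup.lift_apply_of]
    exact comm_N _ _ rfl rfl
  · simp only [map_pow, map_gcomm]
    exact sq_one _ (v_gcomm _ _)
  · simp only [map_gcomm]
    exact comm_N _ _ (v_gcomm _ _) (by simp [yw, gen])
  · simp only [map_pow, map_gcomm]
    exact sq_one _ (v_gcomm _ _)
  · simp only [map_gcomm]
    exact comm_Z _ _ (v_gcomm _ _) (a_gcomm _ _) (b_gcomm _ _ (v_gcomm _ _) (a_gcomm _ _))

def toMod (n : ℕ) : Hn n →* HModel n := PresentedGroup.toGroup (gen_rels n)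

theorem toMod_x (i : Fin n) : toMod n (xH i) = ⟨Pi.single i 1, 0, 0, 0⟩ :=
  PresentedGroup.toGroup.of (gen_rels n)
theorem toMod_y (i : Fin n) : toMod n (yH i) = ⟨0, Pi.single i 1, 0, 0⟩ :=
  PresentedGroup.toGroup.of (gen_rels n)

theorem mem_of {ι : Type*} [Fintype ι] [DecidableEq ι] (R : Subgroup (HModel n))
    (e : (ι → ZMod 2) → HModel n) (e0 : e 0 = 1) (ea : ∀ u w, e (u + w) = e u * e w)
    (h : ∀ i, e (Pi.single i 1) ∈ R) (u : ι → ZMod 2) : e u ∈ R :=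
  pi_mem { carrier := {u | e u ∈ R}
           zero_mem' := by simp [e0, R.one_mem]
           add_mem' := fun {u w} hu hw => by
             simp only [Set.mem_ofPred_eq] at *
             rw [ea]; exact R.mul_mem hu hw } h u

theorem toMod_surj (n : ℕ) : Function.Surjective (toMod n) := by
  rw [← MonoidHom.range_eq_top]
  set R := (toMod n).range with hR
  have hx : ∀ i, (⟨Pi.single i 1, 0, 0, 0⟩ : HModel n) ∈ R := fun i => ⟨xH i, toMod_x i⟩
  have hy : ∀ i, (⟨0, Pi.single i 1, 0, 0⟩ : HModel n) ∈ R := fun i => ⟨yH i, toMod_y i⟩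
  have hb : ∀ p : Fin n × Fin n, (⟨0, 0, Pi.single p 1, 0⟩ : HModel n) ∈ R := by
    rintro ⟨i, j⟩
    have e : (⟨Pi.single i 1, 0, 0, 0⟩ : HModel n) * ⟨0, Pi.single j 1, 0, 0⟩ =
      ⟨0, Pi.single j 1, 0, 0⟩ * ⟨Pi.single i 1, 0, 0, 0⟩ * ⟨0, 0, Pi.single (i, j) 1, 0⟩ := by
      ext p
      · simp
      · simp
      · obtain ⟨k, l⟩ := p
        by_cases h1 : k = i <;> by_cases h2 : l = j <;> simp [Pi.single_apply, h1, h2, two_z]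
      · obtain ⟨⟨⟨k, l⟩, hkl⟩, m⟩ := p
        have hkl' : k ≠ l := ne_of_lt hkl
        by_cases h1 : k = i
        · have h2 : l ≠ i := fun h => hkl' (h1.trans h.symm)
          simp [Pi.single_apply, h1, h2]
        · simp [Pi.single_apply, h1]
    have := R.mul_mem (R.inv_mem (R.mul_mem (hy j) (hx i))) (R.mul_mem (hx i) (hy j))
    rw [e, inv_mul_cancel_left] at this
    exact this
  have hc : ∀ q : PP n × Fin n, (⟨0, 0, 0, Pi.single q 1⟩ : HModel n) ∈ R := by
    rintro ⟨⟨⟨i, k⟩, hik⟩, j⟩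
    have hik' : i < k := hik
    have e : (⟨0, 0, Pi.single (i, j) 1, 0⟩ : HModel n) * ⟨Pi.single k 1, 0, 0, 0⟩ =
      ⟨Pi.single k 1, 0, 0, 0⟩ * ⟨0, 0, Pi.single (i, j) 1, 0⟩ *
        ⟨0, 0, 0, Pi.single (⟨(i, k), hik⟩, j) 1⟩ := by
      ext p
      · simp
      · simp
      · simp
      · obtain ⟨⟨⟨s, t⟩, hst⟩, m⟩ := p
        have hst' : s < t := hst
        by_cases h1 : t = k
        · subst h1
          have : s ≠ t := ne_of_lt hst'
          by_cases h2 : s = i <;> by_cases h3 : m = j <;> simp [Pi.single_apply, h2, h3, this, hik'.ne, hik'.ne']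
        · have : ¬ (s = k ∧ t = i) := by rintro ⟨rfl, rfl⟩; exact lt_asymm hst' hik'
          by_cases h2 : s = k
          · have h3 : t ≠ i := fun h => this ⟨h2, h⟩
            simp [Pi.single_apply, h1, h2, h3]
          · simp [Pi.single_apply, h1, h2]
    have := R.mul_mem (R.inv_mem (R.mul_mem (hx k) (hb (i, j)))) (R.mul_mem (hb (i, j)) (hx k))
    rw [e, inv_mul_cancel_left] at this
    exact this
  have h1 := mem_of R (fun u => ⟨u, 0, 0, 0⟩) rfl (fun u w => by ext <;> simp) hx
  have h2 := mem_of R (fun u => ⟨0, u, 0, 0⟩) rfl (fun u w => by ext <;> simp) hy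
  have h3 := mem_of R (fun u => ⟨0, 0, u, 0⟩) rfl (fun u w => by ext <;> simp) hb
  have h4 := mem_of R (fun u => ⟨0, 0, 0, u⟩) rfl (fun u w => by ext <;> simp) hc
  rw [eq_top_iff]
  rintro ⟨v, a, b, c⟩ -
  have := R.mul_mem (h1 v) (R.mul_mem (h2 a) (R.mul_mem (h3 b) (h4 c)))
  convert this using 1
  ext <;> simp

end HModel

/-! ### Relations in `H(n)` -/
section rel
variable {n : ℕ}

theorem rel_one {w : FreeGroup (HGen n)} (h : w ∈ HRels n) :
    (PresentedGroup.mk (HRels n)) w = 1 := PresentedGroup.one_of_mem h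

def zH (z : HGen n) : Hn n := PresentedGroup.of z

theorem r_sq (z : HGen n) : zH z * zH z = 1 := by
  have := rel_one (n := n) (w := zw z ^ 2) 
    (.inl <| .inl <| .inl <| .inl <| .inl <| .inl ⟨z, rfl⟩)
  rw [map_pow, pow_two] at this; exact this
theorem r_xx (i j : Fin n) : xH i * xH j = xH j * xH i := by
  have := rel_one (n := n) (w := gcomm (xw i) (xw j))
    (.inl <| .inl <| .inl <| .inl <| .inl <| .inr ⟨i, j, rfl⟩)
  rw [map_gcomm, gcomm_one_iff] at this; exact this
theorem r_yy (i j : Fin n) : yH i * yH j = yH j * yH i := by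
  have := rel_one (n := n) (w := gcomm (yw i) (yw j))
    (.inl <| .inl <| .inl <| .inl <| .inr ⟨i, j, rfl⟩)
  rw [map_gcomm, gcomm_one_iff] at this; exact this

def cH (i j : Fin n) : Hn n := gcomm (xH i) (yH j)
def dH (i j k : Fin n) : Hn n := gcomm (cH i j) (xH k)

theorem r_c2 (i j : Fin n) : cH i j * cH i j = 1 := by
  have := rel_one (n := n) (w := gcomm (xw i) (yw j) ^ 2)
    (.inl <| .inl <| .inl <| .inr ⟨i, j, rfl⟩)
  rw [map_pow, map_gcomm, pow_two] at this; exact this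
theorem r_cy (i j k : Fin n) : cH i j * yH k = yH k * cH i j := by
  have := rel_one (n := n) (w := gcomm (gcomm (yw j) (xw i)) (yw k))
    (.inl <| .inl <| .inr ⟨i, j, k, rfl⟩)
  rw [map_gcomm, gcomm_one_iff, map_gcomm] at this
  have e : cH i j = gcomm (yH j) (xH i) := by
    rw [← inv_eq_of_mul_eq_one_right (r_c2 i j)]; simp [cH, gcomm, mul_assoc]
  rw [e]; exact this
theorem r_d2 (i j k : Fin n) : dH i j k * dH i j k = 1 := by
  have := rel_one (n := n) (w := gcomm (gcomm (xw i) (yw j)) (zw (.inl k)) ^ 2)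
    (.inl <| .inr ⟨i, j, .inl k, rfl⟩)
  rw [map_pow, map_gcomm, map_gcomm, pow_two] at this; exact this
theorem r_dz (i j k : Fin n) (z : HGen n) : dH i j k * zH z = zH z * dH i j k := by
  have := rel_one (n := n)
    (w := gcomm (gcomm (gcomm (zw (.inl i)) (zw (.inr j))) (zw (.inl k))) (zw z))
    (.inr ⟨_, _, _, _, rfl⟩)
  rw [map_gcomm, gcomm_one_iff, map_gcomm, map_gcomm] at this; exact this

theorem x_sq (i : Fin n) : xH i * xH i = 1 := r_sq (.inl i)
theorem y_sq (i : Fin n) : yH i * yH i = 1 := r_sq (.inr i)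
theorem x_inv (i : Fin n) : (xH i)⁻¹ = xH i := inv_eq_of_mul_eq_one_right (x_sq i)
theorem y_inv (i : Fin n) : (yH i)⁻¹ = yH i := inv_eq_of_mul_eq_one_right (y_sq i)
theorem c_inv (i j : Fin n) : (cH i j)⁻¹ = cH i j := inv_eq_of_mul_eq_one_right (r_c2 i j)

theorem clos_z (n : ℕ) : Subgroup.closure (Set.range (zH (n := n))) = ⊤ :=
  PresentedGroup.closure_range_of _

theorem d_central (i j k : Fin n) (g : Hn n) : dH i j k * g = g * dH i j k := by
  have h : Subgroup.closure (Set.range (zH (n := n))) ≤ Subgroup.centralizer {dH i j k} := by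
    rw [Subgroup.closure_le]
    rintro _ ⟨z, rfl⟩
    rw [SetLike.mem_coe, Subgroup.mem_centralizer_singleton_iff]
    first | exact (r_dz i j k z) | exact (r_dz i j k z).symm
  rw [clos_z] at h
  have := h (Subgroup.mem_top g)
  rw [Subgroup.mem_centralizer_singleton_iff] at this
  first | exact this | exact this.symm

/-- `x c x = c d` -/
theorem conj_c (i j k : Fin n) : xH k * cH i j * xH k = cH i j * dH i j k := by
  simp only [dH, gcomm, x_inv, mul_assoc, mul_inv_cancel_left]

theorem conj_y (j k : Fin n) : xH k * yH j * xH k = cH k j * yH j := by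
  simp only [cH, gcomm, x_inv, y_inv, mul_assoc, y_sq, mul_one]

theorem d_self (i j : Fin n) : dH i j i = 1 := by
  rw [dH, gcomm_one_iff]
  calc cH i j * xH i = (cH i j)⁻¹ * xH i := by rw [c_inv]
    _ = xH i * cH i j := by
      simp only [cH, gcomm, mul_inv_rev, inv_inv, x_inv, y_inv, mul_assoc, x_sq, mul_one]
      rw [← mul_assoc (xH i) (xH i), x_sq, one_mul]

theorem c_x (i j k : Fin n) : cH i j * xH k = xH k * cH i j * dH i j k := by
  simp only [dH, gcomm, mul_assoc, mul_inv_cancel_left]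

theorem r_cc (i j k l : Fin n) : cH i j * cH k l = cH k l * cH i j := by
  have e : cH k l = xH k * yH l * xH k * yH l := by simp only [cH, gcomm, x_inv, y_inv]
  calc cH i j * cH k l = cH i j * xH k * yH l * xH k * yH l := by rw [e]; group
    _ = xH k * cH i j * (dH i j k * (yH l * xH k * yH l)) := by rw [c_x]; group
    _ = xH k * (cH i j * yH l) * xH k * yH l * dH i j k := by rw [d_central]; group
    _ = xH k * yH l * (cH i j * xH k) * yH l * dH i j k := by rw [r_cy]; group
    _ = xH k * yH l * xH k * cH i j * (dH i j k * yH l) * dH i j k := by rw [c_x]; group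
    _ = xH k * yH l * xH k * (cH i j * yH l) * (dH i j k * dH i j k) := by rw [d_central]; group
    _ = cH k l * cH i j := by rw [r_d2, r_cy, e]; group

theorem d_symm (i j k : Fin n) : dH i j k = dH k j i := by
  have key : ∀ i k : Fin n, xH k * (xH i * yH j * xH i) * xH k =
      cH i j * cH k j * dH i j k * yH j := by
    intro i k
    calc xH k * (xH i * yH j * xH i) * xH k = xH k * (cH i j * yH j) * xH k := by rw [conj_y]
      _ = (xH k * cH i j * xH k) * ((xH k)⁻¹ * yH j * xH k) := by group
      _ = cH i j * (dH i j k * (cH k j * yH j)) := by rw [conj_c, x_inv, conj_y]; group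
      _ = cH i j * cH k j * (yH j * dH i j k) := by rw [d_central]; group
      _ = _ := by rw [← d_central]; group
  have h : xH k * (xH i * yH j * xH i) * xH k = xH i * (xH k * yH j * xH k) * xH i := by
    calc _ = (xH k * xH i) * yH j * (xH i * xH k) := by group
      _ = (xH i * xH k) * yH j * (xH k * xH i) := by rw [r_xx k i]
      _ = _ := by group
  rw [key, key, r_cc k j i j] at h
  exact mul_left_cancel (mul_right_cancel h)

abbrev II (n : ℕ) := Fin n ⊕ (Fin n × Fin n) ⊕ (PP n × Fin n)

def nH : II n → Hn n
  | .inl j => yH j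
  | .inr (.inl p) => cH p.1 p.2
  | .inr (.inr q) => dH q.1.1.1 q.2 q.1.1.2

theorem nH_comm (s t : II n) : nH s * nH t = nH t * nH s := by
  rcases s with s | s | s <;> rcases t with t | t | t <;> simp only [nH]
  · exact r_yy _ _
  · exact (r_cy _ _ _).symm
  · exact (d_central _ _ _ _).symm
  · exact r_cy _ _ _
  · exact r_cc _ _ _ _
  · exact (d_central _ _ _ _).symm
  all_goals exact d_central _ _ _ _

theorem nH_sq (s : II n) : nH s * nH s = 1 := by
  rcases s with s | s | s <;> simp only [nH]
  · exact y_sq _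
  · exact r_c2 _ _
  · exact r_d2 _ _ _

def NH (n : ℕ) : Subgroup (Hn n) := Subgroup.closure (Set.range (nH (n := n)))

theorem y_mem (j : Fin n) : yH j ∈ NH n := Subgroup.subset_closure ⟨.inl j, rfl⟩
theorem c_mem (i j : Fin n) : cH i j ∈ NH n := Subgroup.subset_closure ⟨.inr (.inl (i, j)), rfl⟩
theorem d_mem (i j k : Fin n) : dH i j k ∈ NH n := by
  rcases lt_trichotomy i k with h | h | h
  · exact Subgroup.subset_closure ⟨.inr (.inr (⟨(i, k), h⟩, j)), rfl⟩
  · subst h; rw [d_self]; exact one_mem _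
  · rw [d_symm]; exact Subgroup.subset_closure ⟨.inr (.inr (⟨(k, i), h⟩, j)), rfl⟩

theorem conj_mem_x (k : Fin n) (g : Hn n) (hg : g ∈ NH n) : xH k * g * (xH k)⁻¹ ∈ NH n := by
  have : NH n ≤ (NH n).comap (MulAut.conj (xH k)).toMonoidHom := by
    conv_lhs => rw [NH]
    rw [Subgroup.closure_le]
    rintro _ ⟨s, rfl⟩
    simp only [SetLike.mem_coe, Subgroup.mem_comap, MulEquiv.coe_toMonoidHom, MulAut.conj_apply]
    rw [x_inv]
    rcases s with s | s | s <;> simp only [nH]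
    · rw [conj_y]; exact mul_mem (c_mem _ _) (y_mem _)
    · rw [conj_c]; exact mul_mem (c_mem _ _) (d_mem _ _ _)
    · rw [← d_central, mul_assoc, x_sq, mul_one]; exact d_mem _ _ _
  exact this hg

theorem conj_mem_z (z : HGen n) (g : Hn n) (hg : g ∈ NH n) : zH z * g * (zH z)⁻¹ ∈ NH n := by
  rcases z with k | k
  · exact conj_mem_x k g hg
  · exact mul_mem (mul_mem (y_mem k) hg) (inv_mem (y_mem k))

theorem NH_normal (n : ℕ) : (NH n).Normal := by
  rw [← Subgroup.normalizer_eq_top_iff, eq_top_iff, ← clos_z, Subgroup.closure_le]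
  rintro _ ⟨z, rfl⟩
  rw [SetLike.mem_coe, Subgroup.mem_normalizer_iff]
  intro g
  refine ⟨conj_mem_z z g, fun h => ?_⟩
  have := conj_mem_z z _ h
  have e : (zH z)⁻¹ = zH z := inv_eq_of_mul_eq_one_right (r_sq z)
  rw [e] at this
  have e2 : zH z * (zH z * g * zH z) * zH z = (zH z * zH z) * g * (zH z * zH z) := by group
  rw [e2, r_sq, one_mul, mul_one] at this
  exact this

theorem XN_top (n : ℕ) : XH n ⊔ NH n = ⊤ := by
  rw [eq_top_iff, ← clos_z, Subgroup.closure_le]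
  rintro _ ⟨z, rfl⟩
  rcases z with i | j
  · exact (le_sup_left : XH n ≤ _) (Subgroup.subset_closure ⟨i, rfl⟩)
  · exact (le_sup_right : NH n ≤ _) (y_mem j)

theorem XY_top (n : ℕ) : Subgroup.closure ((XH n : Set (Hn n)) ∪ (YH n : Set (Hn n))) = ⊤ := by
  rw [eq_top_iff, ← clos_z, Subgroup.closure_le]
  rintro _ ⟨z, rfl⟩
  rcases z with i | j
  · exact Subgroup.subset_closure (.inl (Subgroup.subset_closure ⟨i, rfl⟩))
  · exact Subgroup.subset_closure (.inr (Subgroup.subset_closure ⟨j, rfl⟩))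

theorem prod_surj (n : ℕ) :
    Function.Surjective (fun p : XH n × NH n => (p.1 : Hn n) * p.2) := by
  intro g
  have := NH_normal n
  have hg : g ∈ XH n ⊔ NH n := by rw [XN_top]; trivial
  obtain ⟨x, hx, y, hy, rfl⟩ := Subgroup.mem_sup_of_normal_right.1 hg
  exact ⟨(⟨x, hx⟩, ⟨y, hy⟩), rfl⟩

theorem XH_card_le (n : ℕ) : Finite (XH n) ∧ Nat.card (XH n) ≤ 2 ^ n := by
  simpa [XH] using clos_card (xH (n := n)) r_xx x_sq
theorem YH_card_le (n : ℕ) : Finite (YH n) ∧ Nat.card (YH n) ≤ 2 ^ n := by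
  simpa [YH] using clos_card (yH (n := n)) r_yy y_sq
theorem NH_card_le (n : ℕ) : Finite (NH n) ∧
    Nat.card (NH n) ≤ 2 ^ (n + n * n + Fintype.card (PP n) * n) := by
  have h := clos_card (nH (n := n)) nH_comm nH_sq
  refine ⟨h.1, h.2.trans (le_of_eq ?_)⟩
  simp only [Fintype.card_sum, Fintype.card_prod, Fintype.card_fin, add_assoc]

theorem Hn_finite (n : ℕ) : Finite (Hn n) := by
  have := (XH_card_le n).1
  have := (NH_card_le n).1
  exact Finite.of_surjective _ (prod_surj n)

theorem Hn_card_le (n : ℕ) : Nat.card (Hn n) ≤ Nat.card (XH n) * Nat.card (NH n) := by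
  have := (XH_card_le n).1
  have := (NH_card_le n).1
  rw [← Nat.card_prod]
  exact Nat.card_le_card_of_surjective _ (prod_surj n)

theorem Hn_card_ge (n : ℕ) :
    2 ^ n * 2 ^ (n + n * n + Fintype.card (PP n) * n) ≤ Nat.card (Hn n) := by
  have := Hn_finite n
  rw [← HModel.card_eq]
  exact Nat.card_le_card_of_surjective _ (HModel.toMod_surj n)

theorem XH_card (n : ℕ) : Nat.card (XH n) = 2 ^ n := by
  refine le_antisymm (XH_card_le n).2 ?_
  have h := (Hn_card_ge n).trans ((Hn_card_le n).trans (Nat.mul_le_mul_left _ (NH_card_le n).2))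
  exact Nat.le_of_mul_le_mul_right h (by positivity)

theorem Hn_card (n : ℕ) :
    Nat.card (Hn n) = 2 ^ n * 2 ^ (n + n * n + Fintype.card (PP n) * n) :=
  le_antisymm ((Hn_card_le n).trans (Nat.mul_le_mul (XH_card_le n).2 (NH_card_le n).2))
    (Hn_card_ge n)

/-- The abelianization map of the model. -/
def abMod (n : ℕ) : HModel n →* Multiplicative (HGen n → ZMod 2) where
  toFun g := Multiplicative.ofAdd (Sum.elim g.v g.a)
  map_one' := by
    rw [← ofAdd_zero]; congr 1; ext z; rcases z with i | i <;> rfl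
  map_mul' g h := by
    rw [← ofAdd_add]; congr 1; ext z; rcases z with i | i <;> rfl

def abH (n : ℕ) : Hn n →* Multiplicative (HGen n → ZMod 2) := (abMod n).comp (HModel.toMod n)

theorem abH_surj (n : ℕ) : Function.Surjective (abH n) := by
  refine Function.Surjective.comp (g := abMod n) ?_ (HModel.toMod_surj n)
  intro t
  refine ⟨⟨fun i => t.toAdd (.inl i), fun i => t.toAdd (.inr i), 0, 0⟩, ?_⟩
  change Multiplicative.ofAdd _ = _
  rw [← ofAdd_toAdd t]; congr 1; ext z; rcases z with i | i <;> rfl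

theorem YH_card (n : ℕ) : Nat.card (YH n) = 2 ^ n := by
  refine le_antisymm (YH_card_le n).2 ?_
  have := (YH_card_le n).1
  let φ : YH n → (Fin n → ZMod 2) := fun y => (HModel.toMod n y).a
  have hφ : Function.Surjective φ := by
    intro u
    refine pi_mem { carrier := {u | ∃ y, φ y = u}
                    zero_mem' := ⟨1, by simp [φ]⟩
                    add_mem' := ?_ } ?_ u
    · rintro _ _ ⟨y, rfl⟩ ⟨z, rfl⟩
      exact ⟨y * z, by simp [φ]⟩
    · intro i
      exact ⟨⟨yH i, Subgroup.subset_closure ⟨i, rfl⟩⟩, by simp [φ, HModel.toMod_y]⟩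
  have := Nat.card_le_card_of_surjective _ hφ
  simpa using this

theorem ab_card_le (n : ℕ) : Nat.card (Hn n ⧸ commutator (Hn n)) ≤ 2 ^ (2 * n) := by
  have h := clos_card (fun z : HGen n => (QuotientGroup.mk' (commutator (Hn n))) (zH z))
    (fun i j => mul_comm (G := Abelianization (Hn n)) _ _)
    (fun i => by rw [← map_mul, r_sq, map_one])
  have e : Set.range (fun z : HGen n => (QuotientGroup.mk' (commutator (Hn n))) (zH z)) =
      (QuotientGroup.mk' (commutator (Hn n))) '' Set.range (zH (n := n)) := by
    rw [← Set.range_comp]; rfl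
  rw [e, ← MonoidHom.map_closure, clos_z,
    Subgroup.map_top_of_surjective _ (QuotientGroup.mk'_surjective _)] at h
  have h2 := h.2
  rw [Subgroup.card_top] at h2
  simpa [two_mul] using h2

theorem ab_equiv (n : ℕ) :
    Nonempty ((Hn n ⧸ commutator (Hn n)) ≃* (Fin (2 * n) → Multiplicative (ZMod 2))) := by
  have := Hn_finite n
  let φ : (Hn n ⧸ commutator (Hn n)) →* Multiplicative (HGen n → ZMod 2) :=
    QuotientGroup.lift _ (abH n) (Abelianization.commutator_subset_ker (abH n))
  have hs : Function.Surjective φ := by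
    intro t
    obtain ⟨g, hg⟩ := abH_surj n t
    exact ⟨QuotientGroup.mk g, hg⟩
  have hcard : Nat.card (Multiplicative (HGen n → ZMod 2)) = 2 ^ (2 * n) := by
    change Nat.card (HGen n → ZMod 2) = _
    simp [two_mul]
  have hb : Function.Bijective φ := by
    refine (Nat.bijective_iff_surjective_and_card φ).2 ⟨hs, ?_⟩
    refine le_antisymm ?_ (Nat.card_le_card_of_surjective _ hs)
    rw [hcard]; exact ab_card_le n
  let ε : Fin (2 * n) ≃ HGen n := (finCongr (two_mul n)).trans finSumFinEquiv.symm
  let ψ : Multiplicative (HGen n → ZMod 2) ≃* (Fin (2 * n) → Multiplicative (ZMod 2)) :=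
    { toFun := fun t k => Multiplicative.ofAdd (t.toAdd (ε k))
      invFun := fun s => Multiplicative.ofAdd (fun z => (s (ε.symm z)).toAdd)
      left_inv := fun t => by simp
      right_inv := fun s => by simp
      map_mul' := fun s t => rfl }
  exact ⟨(MulEquiv.ofBijective φ hb).trans ψ⟩

end rel

/-- For every `n ≥ 2`, the group `H(n)` is an `n`-dimensional mixed dihedral group relative to
`X` and `Y`, and `|H(n)| = 2^{n(n²+n+4)/2}`. -/
theorem statement0 (n : ℕ) (hn : 2 ≤ n) :
    IsMixedDihedral n (XH n) (YH n) ∧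
    Nat.card (Hn n) = 2 ^ (n * (n ^ 2 + n + 4) / 2) := by
  refine ⟨⟨Hn_finite n, XH_card n, clos_sq _ r_xx x_sq, YH_card n, clos_sq _ r_yy y_sq,
    XY_top n, ab_equiv n⟩, ?_⟩
  rw [Hn_card, ← pow_add]
  congr 1
  have h := card_PP n
  refine (Nat.div_eq_of_eq_mul_left two_pos ?_).symm
  rw [← h]
  nlinarith [congrArg (· * n) h]
end

section
/- Let n ≥ 2 and let H(n) be the presented group defined above. Then for all i, k ∈ {1,…,n} and all j ∈ {1,…,n}, the identity [[x_i, y_j], x_k] = [[x_k, y_j], x_i] holds in H(n), where x_i, x_k, y_j denote the images of the generators in H(n). -/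
theorem aux15 {G : Type*} [Group G] (a b y : G) (ha : a * a = 1) (hb : b * b = 1) (hy : y * y = 1)
    (hab : a * b = b * a) (huy : Commute (gcomm a y) y)
    (hsy : Commute (gcomm (gcomm a y) b) y) (hsb : Commute (gcomm (gcomm a y) b) b)
    (hsa : Commute (gcomm (gcomm a y) b) a)
    (hty : Commute (gcomm (gcomm b y) a) y) (htb : Commute (gcomm (gcomm b y) a) b)
    (hta : Commute (gcomm (gcomm b y) a) a) :
    gcomm (gcomm a y) b = gcomm (gcomm b y) a := by
  have ia : a⁻¹ = a := inv_eq_of_mul_eq_one_left ha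
  have ib : b⁻¹ = b := inv_eq_of_mul_eq_one_left hb
  have iy : y⁻¹ = y := inv_eq_of_mul_eq_one_left hy
  have hu : gcomm a y = a * y * a * y := by simp [gcomm, ia, iy]
  have hv : gcomm b y = b * y * b * y := by simp [gcomm, ib, iy]
  have hs : b * gcomm a y * b = gcomm a y * gcomm (gcomm a y) b := by
    simp only [gcomm, ib]; group
  have ht : a * gcomm b y * a = gcomm b y * gcomm (gcomm b y) a := by
    simp only [gcomm, ia]; group
  have htu : Commute (gcomm (gcomm b y) a) (gcomm a y) := by
    have := ((hta.mul_right hty).mul_right hta).mul_right hty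
    rwa [← hu] at this
  have hsv : Commute (gcomm (gcomm a y) b) (gcomm b y) := by
    have := ((hsb.mul_right hsy).mul_right hsb).mul_right hsy
    rwa [← hv] at this
  generalize gcomm (gcomm a y) b = s at *
  generalize gcomm (gcomm b y) a = t at *
  have hb' : ∀ z, b * (b * z) = z := fun z => by rw [← mul_assoc, hb, one_mul]
  have ha' : ∀ z, a * (a * z) = z := fun z => by rw [← mul_assoc, ha, one_mul]
  have hy' : ∀ z, y * (y * z) = z := fun z => by rw [← mul_assoc, hy, one_mul]
  -- b u b commutes with y
  have hc1 : Commute (b * gcomm a y * b) y := by rw [hs]; exact huy.mul_left hsy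
  have hc2 : Commute (gcomm a y) (b * y * b) := by
    have h := hc1.eq
    have h2 : b * (b * gcomm a y * b * y) * b = b * (y * (b * gcomm a y * b)) * b := by rw [h]
    simp only [mul_assoc, hb', hb, mul_one] at h2
    show _ * _ = _ * _
    simpa only [mul_assoc] using h2
  have huv : Commute (gcomm a y) (gcomm b y) := by
    rw [hv]; exact hc2.mul_right huy
  have e1 : gcomm a y * s * gcomm b y = b * a * y * a * b * y := by
    rw [← hs, hu, hv]; simp only [mul_assoc, hb', hy']
  have e2 : gcomm b y * t * gcomm a y = a * b * y * b * a * y := by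
    rw [← ht, hu, hv]; simp only [mul_assoc, ha', hy']
  have e3 : b * a * y * a * b * y = a * b * y * b * a * y := by
    rw [← hab, mul_assoc (a * b * y) a b, hab, ← mul_assoc]
  have e4 := e1.trans (e3.trans e2.symm)
  rw [mul_assoc, hsv.eq, mul_assoc, htu.eq, ← mul_assoc, ← mul_assoc, huv.eq] at e4
  exact mul_left_cancel e4

theorem gcomm_commute15 {G : Type*} [Group G] {a b : G} (h : gcomm a b = 1) : Commute a b := by
  have h2 : b * a * gcomm a b = a * b := by simp only [gcomm]; group
  rw [h, mul_one] at h2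
  exact h2.symm

theorem map_gcomm15 {G H : Type*} [Group G] [Group H] (f : G →* H) (a b : G) :
    f (gcomm a b) = gcomm (f a) (f b) := by simp [gcomm]

/-- For all `i, j, k`, the identity `[[x_i,y_j],x_k] = [[x_k,y_j],x_i]` holds in `H(n)`. -/
theorem statement15 (n : ℕ) (hn : 2 ≤ n) (i j k : Fin n) :
    gcomm (gcomm (xH i) (yH j)) (xH k) = gcomm (gcomm (xH k) (yH j)) (xH i) := by
  have rel : ∀ w ∈ HRels n, PresentedGroup.mk (HRels n) w = 1 :=
    fun w hw => PresentedGroup.one_of_mem hw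
  have sq : ∀ z : HGen n, (PresentedGroup.of z : Hn n) * PresentedGroup.of z = 1 := fun z => by
    have := rel (zw z ^ 2) (by simp only [HRels, Set.mem_union, Set.mem_setOf_eq]; exact Or.inl (Or.inl (Or.inl (Or.inl (Or.inl (Or.inl ⟨z, rfl⟩))))))
    rw [map_pow, pow_two] at this
    exact this
  have r4 : ∀ z₁ z₂ z₃ z₄ : HGen n, Commute (gcomm (gcomm (PresentedGroup.of z₁ : Hn n)
      (PresentedGroup.of z₂)) (PresentedGroup.of z₃)) (PresentedGroup.of z₄) :=
    fun z₁ z₂ z₃ z₄ => by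
    have := rel (gcomm (gcomm (gcomm (zw z₁) (zw z₂)) (zw z₃)) (zw z₄))
      (Or.inr ⟨z₁, z₂, z₃, z₄, rfl⟩)
    simp only [map_gcomm15] at this
    exact gcomm_commute15 this
  have hxx : Commute (xH i : Hn n) (xH k) := by
    have := rel (gcomm (xw i) (xw k)) (Or.inl (Or.inl (Or.inl (Or.inl (Or.inl (Or.inr ⟨i, k, rfl⟩))))))
    simp only [map_gcomm15] at this
    exact gcomm_commute15 this
  have huy : Commute (gcomm (yH j : Hn n) (xH i)) (yH j) := by
    have := rel (gcomm (gcomm (yw j) (xw i)) (yw j)) (Or.inl (Or.inl (Or.inr ⟨i, j, j, rfl⟩)))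
    simp only [map_gcomm15] at this
    exact gcomm_commute15 this
  have huy' : Commute (gcomm (xH i : Hn n) (yH j)) (yH j) := by
    have h := huy.inv_left
    have e : (gcomm (yH j : Hn n) (xH i))⁻¹ = gcomm (xH i) (yH j) := by
      simp only [gcomm]; group
    rwa [e] at h
  exact aux15 _ _ _ (sq _) (sq _) (sq _) hxx.eq huy' (r4 _ _ _ _) (r4 _ _ _ _) (r4 _ _ _ _)
    (r4 _ _ _ _) (r4 _ _ _ _) (r4 _ _ _ _)
end

section
/- Let n ≥ 2, let H(n) be the presented group defined above, with X = ⟨x_1,…,x_n⟩ and Y = ⟨y_1,…,y_n⟩. Then for every automorphism g₁ of X and every automorphism g₂ of Y, there exists an automorphism φ of H(n) such that φ(x_i) = g₁(x_i) and φ(y_i) = g₂(y_i) for all i = 1,…,n. -/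
lemma xH_mem (n : ℕ) (i : Fin n) : xH i ∈ XH n :=
  Subgroup.subset_closure (Set.mem_range_self i)

lemma yH_mem (n : ℕ) (i : Fin n) : yH i ∈ YH n :=
  Subgroup.subset_closure (Set.mem_range_self i)


section aux
variable {G : Type*} [Group G]

lemma gc_map {K : Type*} [Group K] (f : G →* K) (a b : G) :
    f (gcomm a b) = gcomm (f a) (f b) := by simp [gcomm]

lemma gc_eq_one {a b : G} : gcomm a b = 1 ↔ a * b = b * a := by
  constructor
  · intro h
    have : a * b = b * a * gcomm a b := by simp [gcomm, mul_assoc]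
    rw [this, h, mul_one]
  · intro h
    simp [gcomm, mul_assoc, h]

lemma gc_inv (a b : G) : (gcomm a b)⁻¹ = gcomm b a := by simp [gcomm, mul_assoc]

lemma gc_mul_right (a g h : G) : gcomm a (g * h) = gcomm a h * (h⁻¹ * gcomm a g * h) := by
  simp only [gcomm]; group

lemma gc_mul_left (a g h : G) : gcomm (g * h) a = (h⁻¹ * gcomm g a * h) * gcomm h a := by
  simp only [gcomm]; group

lemma gc_conj (a b h : G) : h⁻¹ * gcomm a b * h = gcomm (h⁻¹ * a * h) (h⁻¹ * b * h) := by
  simp only [gcomm]; group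

lemma gc_right_gen (S : Set G) (hS : Subgroup.closure S = ⊤) (N : Subgroup G) [N.Normal] (a : G)
    (h : ∀ z ∈ S, gcomm a z ∈ N) (g : G) : gcomm a g ∈ N := by
  have hg : g ∈ Subgroup.closure S := hS ▸ Subgroup.mem_top g
  have key : ∀ g : G, gcomm a g ∈ N ↔
      g ∈ (Subgroup.centralizer {(QuotientGroup.mk' N a)}).comap (QuotientGroup.mk' N) := by
    intro g
    rw [Subgroup.mem_comap, Subgroup.mem_centralizer_singleton_iff, ← QuotientGroup.eq_one_iff]
    change QuotientGroup.mk' N (gcomm a g) = 1 ↔ _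
    rw [gc_map, gc_eq_one, eq_comm]
  rw [key]
  refine (Subgroup.closure_le _).2 ?_ hg
  intro z hz
  exact (key z).1 (h z hz)

lemma gc_left_gen (S : Set G) (hS : Subgroup.closure S = ⊤) (N : Subgroup G) [N.Normal] (a : G)
    (h : ∀ z ∈ S, gcomm z a ∈ N) (g : G) : gcomm g a ∈ N := by
  rw [← gc_inv]
  refine N.inv_mem (gc_right_gen S hS N a (fun z hz => ?_) g)
  rw [← gc_inv]
  exact N.inv_mem (h z hz)

lemma gc_central (S : Set G) (hS : Subgroup.closure S = ⊤)
    (h : ∀ z₁ ∈ S, ∀ z₂ ∈ S, ∀ z₃ ∈ S, ∀ z₄ ∈ S, gcomm (gcomm (gcomm z₁ z₂) z₃) z₄ = 1)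
    (a b c : G) : gcomm (gcomm a b) c ∈ Subgroup.center G := by
  have m : ∀ k (x : G), x ∈ Subgroup.upperCentralSeries G (k+1) ↔
      ∀ g, gcomm x g ∈ Subgroup.upperCentralSeries G k := by
    intro k x
    rw [← inv_mem_iff, Subgroup.mem_upperCentralSeries_succ_iff]
    constructor
    · intro H g
      have := H g⁻¹
      simpa [gcomm, commutatorElement_def, mul_assoc] using this
    · intro H g
      have := H g⁻¹
      simpa [gcomm, commutatorElement_def, mul_assoc] using this
  have h1 : ∀ z₁ ∈ S, ∀ z₂ ∈ S, ∀ z₃ ∈ S,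
      gcomm (gcomm z₁ z₂) z₃ ∈ Subgroup.upperCentralSeries G 1 := fun z₁ h₁ z₂ h₂ z₃ h₃ =>
    (m 0 _).2 (gc_right_gen S hS _ _ fun z₄ h₄ => by simp [h z₁ h₁ z₂ h₂ z₃ h₃ z₄ h₄])
  have h2 : ∀ z₁ ∈ S, ∀ z₂ ∈ S,
      gcomm z₁ z₂ ∈ Subgroup.upperCentralSeries G 2 := fun z₁ h₁ z₂ h₂ =>
    (m 1 _).2 (gc_right_gen S hS _ _ fun z₃ h₃ => h1 z₁ h₁ z₂ h₂ z₃ h₃)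
  have h3 : gcomm a b ∈ Subgroup.upperCentralSeries G 2 :=
    gc_left_gen S hS _ _ (fun z hz => gc_right_gen S hS _ _ (fun w hw => h2 z hz w hw) b) a
  have := (m 1 _).1 h3 c
  simpa using this

lemma gc_comm (h : ∀ a b c : G, gcomm (gcomm a b) c ∈ Subgroup.center G) (a b c d : G) :
    gcomm a b * gcomm c d = gcomm c d * gcomm a b := by
  have key : ∀ x y u v : G, u ∈ Subgroup.center G → v ∈ Subgroup.center G →
      gcomm (x * u) (y * v) = gcomm x y := by
    intro x y u v hu hv
    rw [gc_mul_right, gc_mul_left, gc_mul_left]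
    rw [Subgroup.mem_center_iff] at hu hv
    have e1 : gcomm x v = 1 := gc_eq_one.2 (hv x)
    have e2 : gcomm u v = 1 := gc_eq_one.2 (hv u)
    have e3 : gcomm u y = 1 := gc_eq_one.2 (hu y).symm
    rw [e1, e2, e3, mul_assoc u⁻¹, hu, mul_one, mul_assoc v⁻¹, hv]
    simp [mul_assoc, hu]
  have cj : ∀ x : G, (gcomm a b)⁻¹ * x * gcomm a b = x * (gcomm (gcomm a b) x)⁻¹ := by
    intro x; simp only [gcomm]; group
  have := gc_conj c d (gcomm a b)
  rw [cj c, cj d, key _ _ _ _ (inv_mem (h _ _ _)) (inv_mem (h _ _ _))] at this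
  rw [mul_assoc, inv_mul_eq_iff_eq_mul] at this
  exact this.symm

lemma gc_sq_right (S : Set G) (hS : Subgroup.closure S = ⊤)
    (hc : ∀ a b c d : G, gcomm a b * gcomm c d = gcomm c d * gcomm a b)
    (a : G) (h : ∀ z ∈ S, gcomm a z ^ 2 = 1) (g : G) : gcomm a g ^ 2 = 1 := by
  have hg : g ∈ Subgroup.closure S := hS ▸ Subgroup.mem_top g
  have hm : ∀ x y, gcomm a x ^ 2 = 1 → gcomm a y ^ 2 = 1 → gcomm a (x * y) ^ 2 = 1 := by
    intro x y hx hy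
    rw [gc_mul_right, Commute.mul_pow, hy, one_mul]
    · have : y⁻¹ * gcomm a x * y = y⁻¹ * gcomm a x * (y⁻¹)⁻¹ := by simp
      rw [this, conj_pow, hx]; simp
    · rw [gc_conj]; exact hc _ _ _ _
  induction hg using Subgroup.closure_induction with
  | mem x hx => exact h x hx
  | one => simp [gcomm]
  | mul x y _ _ hx hy => exact hm x y hx hy
  | inv x _ hx =>
    have : gcomm a x⁻¹ = x * (gcomm a x)⁻¹ * x⁻¹ := by simp only [gcomm]; group
    rw [this, conj_pow, inv_pow, hx]; simp

lemma gc_sq (S : Set G) (hS : Subgroup.closure S = ⊤)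
    (hc : ∀ a b c d : G, gcomm a b * gcomm c d = gcomm c d * gcomm a b)
    (h : ∀ z ∈ S, ∀ w ∈ S, gcomm z w ^ 2 = 1) (a b : G) : gcomm a b ^ 2 = 1 := by
  refine gc_sq_right S hS hc a (fun z hz => ?_) b
  rw [← gc_inv, inv_pow, gc_sq_right S hS hc z (fun w hw => h z hz w hw) a, inv_one]

lemma closure_sq (S : Set G) (h2 : ∀ z ∈ S, z ^ 2 = 1) (hc : ∀ z ∈ S, ∀ w ∈ S, z * w = w * z) :
    (∀ a ∈ Subgroup.closure S, ∀ b ∈ Subgroup.closure S, a * b = b * a) ∧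
    ∀ a ∈ Subgroup.closure S, a ^ 2 = 1 := by
  have A : ∀ a ∈ Subgroup.closure S, ∀ b ∈ Subgroup.closure S, a * b = b * a := by
    have h1 : Subgroup.closure S ≤ Subgroup.centralizer S :=
      (Subgroup.closure_le _).2 fun z hz => Subgroup.mem_centralizer_iff.2 fun w hw => hc w hw z hz
    have h3 : Subgroup.closure S ≤ Subgroup.centralizer (Subgroup.closure S : Set G) :=
      (Subgroup.closure_le _).2 fun z hz => Subgroup.mem_centralizer_iff.2 fun w hw =>
        ((Subgroup.mem_centralizer_iff.1 (h1 hw)) z hz).symm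
    intro a ha b hb
    exact Subgroup.mem_centralizer_iff.1 (h3 hb) a ha
  refine ⟨A, fun a ha => ?_⟩
  induction ha using Subgroup.closure_induction with
  | mem x hx => exact h2 x hx
  | one => simp
  | mul x y hx hy ex ey =>
    rw [Commute.mul_pow (A x hx y hy), ex, ey, one_mul]
  | inv x _ ex => rw [inv_pow, ex, inv_one]

lemma gc_cent (S T : Set G)
    (hz : ∀ a b c : G, gcomm (gcomm a b) c ∈ Subgroup.center G)
    (h : ∀ s ∈ S, ∀ t ∈ T, ∀ t' ∈ T, gcomm (gcomm t s) t' = 1)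
    (x : G) (hx : x ∈ Subgroup.closure S) (y : G) (hy : y ∈ Subgroup.closure T)
    (y' : G) (hy' : y' ∈ Subgroup.closure T) : gcomm (gcomm y x) y' = 1 := by
  set C := Subgroup.centralizer (Subgroup.closure T : Set G) with hC
  have hZC : Subgroup.center G ≤ C := Subgroup.center_le_centralizer _
  have cj : ∀ a b g : G, gcomm a b ∈ C → g⁻¹ * gcomm a b * g ∈ C := by
    intro a b g hab
    have : g⁻¹ * gcomm a b * g = gcomm a b * gcomm (gcomm a b) g := by
      simp only [gcomm]; group
    rw [this]
    exact C.mul_mem hab (hZC (hz _ _ _))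
  have h0 : ∀ s ∈ S, ∀ t ∈ T, gcomm t s ∈ C := by
    intro s hs t ht
    have : Subgroup.closure T ≤ Subgroup.centralizer {gcomm t s} :=
      (Subgroup.closure_le _).2 fun t' ht' =>
        Subgroup.mem_centralizer_singleton_iff.2 (gc_eq_one.1 (h s hs t ht t' ht')).symm
    exact Subgroup.mem_centralizer_iff.2 fun w hw =>
      Subgroup.mem_centralizer_singleton_iff.1 (this hw)
  have h1 : ∀ t ∈ T, gcomm t x ∈ C := by
    intro t ht
    induction hx using Subgroup.closure_induction with
    | mem s hs => exact h0 s hs t ht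
    | one => simp [gcomm]
    | mul a b _ _ ha hb => rw [gc_mul_right]; exact C.mul_mem hb (cj _ _ _ ha)
    | inv a _ ha =>
      have : gcomm t a⁻¹ = (a⁻¹)⁻¹ * gcomm a t * a⁻¹ := by simp only [gcomm]; group
      rw [this]
      apply cj
      rw [← gc_inv]; exact C.inv_mem ha
  have h2 : gcomm y x ∈ C := by
    induction hy using Subgroup.closure_induction with
    | mem t ht => exact h1 t ht
    | one => simp [gcomm]
    | mul a b _ _ ha hb => rw [gc_mul_left]; exact C.mul_mem (cj _ _ _ ha) hb
    | inv a _ ha =>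
      have : gcomm a⁻¹ x = (a⁻¹)⁻¹ * gcomm x a * a⁻¹ := by simp only [gcomm]; group
      rw [this]
      apply cj
      rw [← gc_inv]; exact C.inv_mem ha
  exact gc_eq_one.2 (Subgroup.mem_centralizer_iff.1 h2 y' hy').symm

lemma ext_closure (S : Set G) (f : Subgroup.closure S →* Subgroup.closure S) (φ : G →* G)
    (h : ∀ s (hs : s ∈ S), φ s = f ⟨s, Subgroup.subset_closure hs⟩)
    (x : Subgroup.closure S) : φ x = f x := by
  obtain ⟨x, hx⟩ := x
  induction hx using Subgroup.closure_induction with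
  | mem s hs => exact h s hs
  | one => exact (map_one φ).trans (congrArg Subtype.val (map_one f)).symm
  | mul a b ha hb ea eb =>
    have := congrArg Subtype.val (map_mul f ⟨a, ha⟩ ⟨b, hb⟩)
    refine (map_mul φ a b).trans (Eq.trans ?_ this.symm)
    exact congrArg₂ (· * ·) ea eb
  | inv a ha ea =>
    have := congrArg Subtype.val (map_inv f ⟨a, ha⟩)
    refine (map_inv φ a).trans (Eq.trans ?_ this.symm)
    exact congrArg (·⁻¹) ea

end aux

lemma Hn_rel {n : ℕ} {w : FreeGroup (HGen n)} (hw : w ∈ HRels n) :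
    PresentedGroup.mk (HRels n) w = 1 :=
  PresentedGroup.one_of_mem hw

lemma mk_zw {n : ℕ} (z : HGen n) :
    PresentedGroup.mk (HRels n) (zw z) = PresentedGroup.of z := rfl
lemma mk_xw {n : ℕ} (z : Fin n) : PresentedGroup.mk (HRels n) (xw z) = xH z := rfl
lemma mk_yw {n : ℕ} (z : Fin n) : PresentedGroup.mk (HRels n) (yw z) = yH z := rfl

lemma Hn_extend (n : ℕ) (f₁ : ↥(XH n) →* ↥(XH n)) (f₂ : ↥(YH n) →* ↥(YH n)) :
    ∃ φ : Hn n →* Hn n, (∀ x : ↥(XH n), φ x = f₁ x) ∧ (∀ y : ↥(YH n), φ y = f₂ y) := by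
  have hS : Subgroup.closure (Set.range (PresentedGroup.of : HGen n → Hn n)) = ⊤ :=
    PresentedGroup.closure_range_of _
  have r1 : ∀ z : HGen n, (PresentedGroup.of z : Hn n) ^ 2 = 1 := fun z => by
    have := Hn_rel (n := n) (w := zw z ^ 2) 
      (Or.inl <| Or.inl <| Or.inl <| Or.inl <| Or.inl <| Or.inl ⟨z, rfl⟩)
    simpa [gc_map, mk_zw] using this
  have r2 : ∀ i j : Fin n, gcomm (xH i : Hn n) (xH j) = 1 := fun i j => by
    have := Hn_rel (n := n) (w := gcomm (xw i) (xw j))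
      (Or.inl <| Or.inl <| Or.inl <| Or.inl <| Or.inl <| Or.inr ⟨i, j, rfl⟩)
    simpa [gc_map, mk_xw] using this
  have r3 : ∀ i j : Fin n, gcomm (yH i : Hn n) (yH j) = 1 := fun i j => by
    have := Hn_rel (n := n) (w := gcomm (yw i) (yw j))
      (Or.inl <| Or.inl <| Or.inl <| Or.inl <| Or.inr ⟨i, j, rfl⟩)
    simpa [gc_map, mk_yw] using this
  have r4 : ∀ i j : Fin n, gcomm (xH i : Hn n) (yH j) ^ 2 = 1 := fun i j => by
    have := Hn_rel (n := n) (w := gcomm (xw i) (yw j) ^ 2)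
      (Or.inl <| Or.inl <| Or.inl <| Or.inr ⟨i, j, rfl⟩)
    simpa [gc_map, mk_xw, mk_yw] using this
  have r5 : ∀ i j k : Fin n, gcomm (gcomm (yH j : Hn n) (xH i)) (yH k) = 1 := fun i j k => by
    have := Hn_rel (n := n) (w := gcomm (gcomm (yw j) (xw i)) (yw k))
      (Or.inl <| Or.inl <| Or.inr ⟨i, j, k, rfl⟩)
    simpa [gc_map, mk_xw, mk_yw] using this
  have r7 : ∀ a b c d : HGen n, gcomm (gcomm (gcomm (PresentedGroup.of a : Hn n)
      (PresentedGroup.of b)) (PresentedGroup.of c)) (PresentedGroup.of d) = 1 := fun a b c d => by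
    have := Hn_rel (n := n) (w := gcomm (gcomm (gcomm (zw a) (zw b)) (zw c)) (zw d))
      (Or.inr ⟨a, b, c, d, rfl⟩)
    simpa [gc_map, mk_zw] using this
  have hz : ∀ a b c : Hn n, gcomm (gcomm a b) c ∈ Subgroup.center (Hn n) := by
    refine gc_central _ hS ?_
    rintro _ ⟨a, rfl⟩ _ ⟨b, rfl⟩ _ ⟨c, rfl⟩ _ ⟨d, rfl⟩
    exact r7 a b c d
  have h4 : ∀ a b c d : Hn n, gcomm (gcomm (gcomm a b) c) d = 1 := fun a b c d =>
    gc_eq_one.2 (Subgroup.mem_center_iff.1 (hz a b c) d).symm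
  have hc := gc_comm hz
  have hsq : ∀ a b : Hn n, gcomm a b ^ 2 = 1 := by
    refine gc_sq _ hS hc ?_
    rintro _ ⟨a | a, rfl⟩ _ ⟨b | b, rfl⟩
    · change gcomm (xH a) (xH b) ^ 2 = 1
      rw [r2, one_pow]
    · exact r4 a b
    · change gcomm (yH a) (xH b) ^ 2 = 1
      rw [← gc_inv, inv_pow, r4, inv_one]
    · change gcomm (yH a) (yH b) ^ 2 = 1
      rw [r3, one_pow]
  have hX := closure_sq (Set.range (xH (n := n))) (by rintro _ ⟨a, rfl⟩; exact r1 _)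
    (by rintro _ ⟨a, rfl⟩ _ ⟨b, rfl⟩; exact gc_eq_one.1 (r2 a b))
  have hY := closure_sq (Set.range (yH (n := n))) (by rintro _ ⟨a, rfl⟩; exact r1 _)
    (by rintro _ ⟨a, rfl⟩ _ ⟨b, rfl⟩; exact gc_eq_one.1 (r3 a b))
  have hYXY := gc_cent (Set.range (xH (n := n))) (Set.range (yH (n := n))) hz
    (by rintro _ ⟨a, rfl⟩ _ ⟨b, rfl⟩ _ ⟨c, rfl⟩; exact r5 a b c)
  let F : HGen n → Hn n := Sum.elim (fun i => (f₁ ⟨xH i, xH_mem n i⟩ : Hn n))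
    (fun i => (f₂ ⟨yH i, yH_mem n i⟩ : Hn n))
  have Fx : ∀ i, FreeGroup.lift F (xw i) ∈ Subgroup.closure (Set.range (xH (n := n))) := fun i => by
    simp only [xw, FreeGroup.lift_apply_of]; exact (f₁ ⟨xH i, xH_mem n i⟩).2
  have Fy : ∀ i, FreeGroup.lift F (yw i) ∈ Subgroup.closure (Set.range (yH (n := n))) := fun i => by
    simp only [yw, FreeGroup.lift_apply_of]; exact (f₂ ⟨yH i, yH_mem n i⟩).2
  have hF : ∀ r ∈ HRels n, FreeGroup.lift F r = 1 := by
    rintro r ((((((⟨z, rfl⟩ | ⟨i, j, rfl⟩) | ⟨i, j, rfl⟩) | ⟨i, j, rfl⟩) | ⟨i, j, k, rfl⟩) |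
      ⟨i, j, z, rfl⟩) | ⟨a, b, c, d, rfl⟩)
    · rw [map_pow]
      rcases z with i | i
      · exact hX.2 _ (Fx i)
      · exact hY.2 _ (Fy i)
    · rw [gc_map]; exact gc_eq_one.2 (hX.1 _ (Fx i) _ (Fx j))
    · rw [gc_map]; exact gc_eq_one.2 (hY.1 _ (Fy i) _ (Fy j))
    · rw [map_pow, gc_map]; exact hsq _ _
    · rw [gc_map, gc_map]; exact hYXY _ (Fx i) _ (Fy j) _ (Fy k)
    · rw [map_pow, gc_map]; exact hsq _ _
    · rw [gc_map, gc_map, gc_map]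
      exact h4 _ _ _ _
  refine ⟨PresentedGroup.toGroup hF, ext_closure _ f₁ _ ?_, ext_closure _ f₂ _ ?_⟩
  · rintro _ ⟨i, rfl⟩
    exact PresentedGroup.toGroup.of hF
  · rintro _ ⟨i, rfl⟩
    exact PresentedGroup.toGroup.of hF

/-- Every pair `(g₁, g₂)` of automorphisms of `X` and of `Y` extends to (induces) an
automorphism `φ` of `H(n)` with `φ(x_i) = g₁(x_i)` and `φ(y_i) = g₂(y_i)` for all `i`. -/
theorem statement18 (n : ℕ) (hn : 2 ≤ n)
    (g₁ : ↥(XH n) ≃* ↥(XH n)) (g₂ : ↥(YH n) ≃* ↥(YH n)) :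
    ∃ φ : Hn n ≃* Hn n,
      (∀ i : Fin n, φ (xH i) = ↑(g₁ ⟨xH i, xH_mem n i⟩)) ∧
      (∀ i : Fin n, φ (yH i) = ↑(g₂ ⟨yH i, yH_mem n i⟩)) := by

  obtain ⟨φ, h1, h2⟩ := Hn_extend n g₁.toMonoidHom g₂.toMonoidHom
  obtain ⟨ψ, k1, k2⟩ := Hn_extend n g₁.symm.toMonoidHom g₂.symm.toMonoidHom
  refine ⟨MonoidHom.toMulEquiv φ ψ ?_ ?_, fun i => h1 ⟨xH i, xH_mem n i⟩,
    fun i => h2 ⟨yH i, yH_mem n i⟩⟩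
  · apply PresentedGroup.ext
    rintro (i | i)
    · change ψ (φ ((⟨xH i, xH_mem n i⟩ : XH n) : Hn n)) = xH i
      rw [h1, k1]; simp
    · change ψ (φ ((⟨yH i, yH_mem n i⟩ : YH n) : Hn n)) = yH i
      rw [h2, k2]; simp
  · apply PresentedGroup.ext
    rintro (i | i)
    · change φ (ψ ((⟨xH i, xH_mem n i⟩ : XH n) : Hn n)) = xH i
      rw [k1, h1]; simp
    · change φ (ψ ((⟨yH i, yH_mem n i⟩ : YH n) : Hn n)) = yH i
      rw [k2, h2]; simp
end
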